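/- Let m be a positive integer, τ ∈ ℝ with τ ≠ 0 and τ ≠ 1, let P, Q be m×m Hermitian positive definite complex matrices, and let T be an invertible m×m complex matrix. For Hermitian positive definite matrices P', Q' define D_T^{(τ)}(P'‖Q') := tr[(1/(τ(τ−1)))(L⁻¹ P' L⁻*)^τ − (1/(τ−1)) P' Q'⁻¹] + m/τ, where L is any invertible matrix with L·L* = Q' (the value does not depend on the choice of L). Then D_T^{(τ)}(T* P T ‖ T* Q T) = D_T^{(τ)}(P‖Q). -/

import Mathlib

open Matrix
open scoped Classical ComplexOrder

/-- Real power of a matrix via the spectral calculus (junk value `0` if not Hermitian). -/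
noncomputable def mPow {n : ℕ} (A : Matrix (Fin n) (Fin n) ℂ) (τ : ℝ) :
    Matrix (Fin n) (Fin n) ℂ :=
  if hA : A.IsHermitian then
    (hA.eigenvectorUnitary : Matrix (Fin n) (Fin n) ℂ) *
      Matrix.diagonal (fun i => ((hA.eigenvalues i ^ τ : ℝ) : ℂ)) *
      (star hA.eigenvectorUnitary : Matrix (Fin n) (Fin n) ℂ)
  else 0

/-- The matrix divergence `D_T^{(τ)}(P‖Q)` computed with the factor `L` of `Q = L·L*`:
`tr[(1/(τ(τ−1)))(L⁻¹ P L⁻*)^τ − (1/(τ−1)) P Q⁻¹] + m/τ`. -/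
noncomputable def Dtau {m : ℕ} (τ : ℝ) (P Q L : Matrix (Fin m) (Fin m) ℂ) : ℝ :=
  (Matrix.trace ((1 / (τ * (τ - 1)) : ℝ) • mPow (L⁻¹ * P * (Lᴴ)⁻¹) τ -
      (1 / (τ - 1) : ℝ) • (P * Q⁻¹))).re + m / τ

theorem trace_mPow {n : ℕ} {A : Matrix (Fin n) (Fin n) ℂ} (hA : A.IsHermitian) (τ : ℝ) :
    (mPow A τ).trace = ∑ i, ((hA.eigenvalues i ^ τ : ℝ) : ℂ) := by
  rw [mPow, dif_pos hA, Matrix.trace_mul_cycle, Unitary.coe_star_mul_self, one_mul,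
    Matrix.trace_diagonal]

theorem trace_mPow_eq_of_charpoly_eq {n : ℕ} {A B : Matrix (Fin n) (Fin n) ℂ}
    (hA : A.IsHermitian) (hB : B.IsHermitian) (h : A.charpoly = B.charpoly) (τ : ℝ) :
    (mPow A τ).trace = (mPow B τ).trace := by
  rw [trace_mPow hA, trace_mPow hB, (hA.eigenvalues_eq_eigenvalues_iff hB).2 h]

theorem isHermitian_inv_mul_mul_conjTranspose_inv {n : ℕ} {P : Matrix (Fin n) (Fin n) ℂ}
    (hP : P.IsHermitian) (L : Matrix (Fin n) (Fin n) ℂ) :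
    (L⁻¹ * P * (Lᴴ)⁻¹).IsHermitian := by
  rw [← Matrix.conjTranspose_nonsing_inv]
  exact Matrix.isHermitian_mul_mul_conjTranspose _ hP

theorem charpoly_inv_mul_mul_conjTranspose_inv {n : ℕ} (P L : Matrix (Fin n) (Fin n) ℂ) :
    (L⁻¹ * P * (Lᴴ)⁻¹).charpoly = (P * (L * Lᴴ)⁻¹).charpoly := by
  rw [mul_assoc, Matrix.charpoly_mul_comm, mul_assoc, Matrix.mul_inv_rev]

theorem congruence_mul_inv_congruence {n : ℕ} (P Q : Matrix (Fin n) (Fin n) ℂ)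
    {T : Matrix (Fin n) (Fin n) ℂ} (hT : IsUnit T.det) :
    Tᴴ * P * T * (Tᴴ * Q * T)⁻¹ = Tᴴ * (P * Q⁻¹ * (Tᴴ)⁻¹) := by
  simp only [Matrix.mul_inv_rev, mul_assoc, Matrix.mul_nonsing_inv_cancel_left _ _ hT]

/-- the divergence `D_T^{(τ)}` is invariant under congruence transformations:
`D_T^{(τ)}(T*PT ‖ T*QT) = D_T^{(τ)}(P‖Q)` (computed with any invertible factors
`L₁·L₁* = T*QT` and `L₂·L₂* = Q`, the value being independent of these choices). -/
theorem Dtau_congruence_invariant {m : ℕ} (hm : 0 < m) (τ : ℝ) (hτ0 : τ ≠ 0) (hτ1 : τ ≠ 1)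
    (P Q T : Matrix (Fin m) (Fin m) ℂ) (hP : P.PosDef) (hQ : Q.PosDef)
    (hT : IsUnit T.det)
    (L₁ : Matrix (Fin m) (Fin m) ℂ) (hL₁ : IsUnit L₁.det) (hL₁Q : L₁ * L₁ᴴ = Tᴴ * Q * T)
    (L₂ : Matrix (Fin m) (Fin m) ℂ) (hL₂ : IsUnit L₂.det) (hL₂Q : L₂ * L₂ᴴ = Q) :
    Dtau τ (Tᴴ * P * T) (Tᴴ * Q * T) L₁ = Dtau τ P Q L₂ := by
  have hT' : IsUnit (Tᴴ).det := by
    rw [Matrix.det_conjTranspose]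
    exact hT.star
  have hchar : (Tᴴ * P * T * (Tᴴ * Q * T)⁻¹).charpoly = (P * Q⁻¹).charpoly := by
    rw [congruence_mul_inv_congruence P Q hT, Matrix.charpoly_mul_comm,
      Matrix.nonsing_inv_mul_cancel_right _ _ hT']
  have htrace : (Tᴴ * P * T * (Tᴴ * Q * T)⁻¹).trace = (P * Q⁻¹).trace := by
    rw [congruence_mul_inv_congruence P Q hT, Matrix.trace_mul_comm,
      Matrix.nonsing_inv_mul_cancel_right _ _ hT']
  have hpow : (mPow (L₁⁻¹ * (Tᴴ * P * T) * (L₁ᴴ)⁻¹) τ).trace =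
      (mPow (L₂⁻¹ * P * (L₂ᴴ)⁻¹) τ).trace := by
    apply trace_mPow_eq_of_charpoly_eq
    · exact isHermitian_inv_mul_mul_conjTranspose_inv
        (Matrix.isHermitian_conjTranspose_mul_mul T hP.isHermitian) L₁
    · exact isHermitian_inv_mul_mul_conjTranspose_inv hP.isHermitian L₂
    · rw [charpoly_inv_mul_mul_conjTranspose_inv, charpoly_inv_mul_mul_conjTranspose_inv,
        hL₁Q, hL₂Q, hchar]
  simp only [Dtau, Matrix.trace_sub, Matrix.trace_smul, hpow, htrace]
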